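/- Assume condition (G) for some γ ∈ ℕ, d > 0 and L > 0. Let 0 ≤ k < L with [k]+1 ≤ γ and let ℓ ∈ [0,k]. Then for every φ ∈ L¹_k satisfying ∫_{ℝ^N} x^α φ(x) dx = 0 for all multi-indices α with |α| ≤ k, one has lim_{t→∞} t^{(k−ℓ)/d} ∫_{ℝ^N} |x|^ℓ |(e^{tℒ}φ)(x)| dx = 0. -/

import Mathlib

open MeasureTheory Filter Asymptotics Topology
open scoped ENNReal BigOperators

noncomputable section

/-- Partial derivative in the `i`-th coordinate direction. -/
def pderivE (N : ℕ) (i : Fin N) (f : EuclideanSpace ℝ (Fin N) → ℝ) :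
    EuclideanSpace ℝ (Fin N) → ℝ :=
  fun x => fderiv ℝ f x (EuclideanSpace.single i 1)

/-- Multi-index partial derivative `∂_x^α`. -/
def mderivE (N : ℕ) (α : Fin N → ℕ) (f : EuclideanSpace ℝ (Fin N) → ℝ) :
    EuclideanSpace ℝ (Fin N) → ℝ :=
  (List.ofFn fun i : Fin N => (pderivE N i)^[α i]).foldr (fun T h => T h) f

/-- `x ^ α` for a multi-index `α`. -/
def mpowE (N : ℕ) (α : Fin N → ℕ) (x : EuclideanSpace ℝ (Fin N)) : ℝ :=
  ∏ i, x i ^ α i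

/-- `α !` for a multi-index `α`. -/
def mfactE (N : ℕ) (α : Fin N → ℕ) : ℕ := ∏ i, Nat.factorial (α i)

/-- `g_α(x,t) := ((-1)^{|α|}/α!) ∂_x^α G(x, t+1)`. -/
def gA (N : ℕ) (G : EuclideanSpace ℝ (Fin N) → ℝ → ℝ) (α : Fin N → ℕ)
    (x : EuclideanSpace ℝ (Fin N)) (t : ℝ) : ℝ :=
  ((-1 : ℝ) ^ (∑ i, α i) / (mfactE N α : ℝ)) * mderivE N α (fun y => G y (t + 1)) x

/-- Condition (G) for the kernel `G` with parameters `γ`, `d`, `L`. -/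
structure CondG (N : ℕ) (G : EuclideanSpace ℝ (Fin N) → ℝ → ℝ) (γ : ℕ) (d L : ℝ) : Prop where
  smooth : ContDiffOn ℝ γ (fun p : EuclideanSpace ℝ (Fin N) × ℝ => G p.1 p.2) {p | 0 < p.2}
  scaling : ∀ x : EuclideanSpace ℝ (Fin N), ∀ t : ℝ, 0 < t →
      G x t = t ^ (-(N : ℝ) / d) * G ((t ^ (-(1 : ℝ) / d)) • x) 1
  decay : ∀ j : ℕ, j ≤ γ → ∃ C : ℝ, ∀ x : EuclideanSpace ℝ (Fin N),
      (1 + ‖x‖) ^ ((N : ℝ) + L + j) * ‖iteratedFDeriv ℝ j (fun y => G y 1) x‖ ≤ C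
  semigroup : ∀ x : EuclideanSpace ℝ (Fin N), ∀ t s : ℝ, 0 < s → s < t →
      G x t = ∫ y, G (x - y) (t - s) * G y s

/-- `(e^{tℒ}φ)(x) = ∫ G(x-y,t) φ(y) dy`. -/
def sgOp (N : ℕ) (G : EuclideanSpace ℝ (Fin N) → ℝ → ℝ) (t : ℝ)
    (φ : EuclideanSpace ℝ (Fin N) → ℝ) : EuclideanSpace ℝ (Fin N) → ℝ :=
  fun x => ∫ y, G (x - y) t * φ y

/-- `∫ x^α f(x) dx`. -/
def momE (N : ℕ) (α : Fin N → ℕ) (f : EuclideanSpace ℝ (Fin N) → ℝ) : ℝ :=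
  ∫ x, mpowE N α x * f x

/-- Auxiliary fuelled recursion computing the coefficients `M_α(f,t)`. -/
def McoefAux (N : ℕ) (G : EuclideanSpace ℝ (Fin N) → ℝ → ℝ)
    (f : EuclideanSpace ℝ (Fin N) → ℝ) (t : ℝ) : ℕ → (Fin N → ℕ) → ℝ
  | 0, α => momE N α f
  | n + 1, α => momE N α f -
      ∑ β ∈ (Finset.Iic α).erase α,
        McoefAux N G f t n β * ∫ x, mpowE N α x * gA N G β x t

/-- `M_α(f,t)`, defined inductively on `|α|`:
`M_α(f,t) = ∫ x^α f dx - ∑_{β ≤ α, β ≠ α} M_β(f,t) ∫ x^α g_β(x,t) dx`. -/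
def Mcoef (N : ℕ) (G : EuclideanSpace ℝ (Fin N) → ℝ → ℝ)
    (f : EuclideanSpace ℝ (Fin N) → ℝ) (t : ℝ) (α : Fin N → ℕ) : ℝ :=
  McoefAux N G f t (∑ i, α i) α

/-- The finite set of multi-indices `α` with `|α| ≤ m`. -/
def multiIdx (N m : ℕ) : Finset (Fin N → ℕ) :=
  (Finset.Iic fun _ => m).filter fun α => ∑ i, α i ≤ m

/-- `P_K(t)f := f - ∑_{|α| ≤ K} M_α(f,t) g_α(·,t)`. -/
def PKop (N : ℕ) (G : EuclideanSpace ℝ (Fin N) → ℝ → ℝ) (K : ℝ) (t : ℝ)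
    (f : EuclideanSpace ℝ (Fin N) → ℝ) : EuclideanSpace ℝ (Fin N) → ℝ :=
  fun x => f x - ∑ α ∈ multiIdx N ⌊K⌋₊, Mcoef N G f t α * gA N G α x t

/-- The weighted `L¹` norm `|||φ|||_k = ∫ (1+|x|^k) ‖φ(x)‖ dx`, valued in `ℝ≥0∞`. -/
def wnorm (N : ℕ) {E' : Type*} [NormedAddCommGroup E'] (k : ℝ)
    (φ : EuclideanSpace ℝ (Fin N) → E') : ℝ≥0∞ :=
  ∫⁻ x, ENNReal.ofReal ((1 + ‖x‖ ^ k) * ‖φ x‖)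

/-- Membership in `L¹_k = L¹(ℝ^N, (1+|x|^k)dx)`. -/
def MemL1k (N : ℕ) (k : ℝ) (φ : EuclideanSpace ℝ (Fin N) → ℝ) : Prop :=
  AEStronglyMeasurable φ (volume : Measure (EuclideanSpace ℝ (Fin N))) ∧ wnorm N k φ < ⊤

/-- `E_{K,q}[f](t) = (1+t)^{K/d}[t^{(N/d)(1-1/q)} ‖f(t)‖_q + ‖f(t)‖_1] + |||f(t)|||_K`. -/
def Efun (N : ℕ) (d K : ℝ) (q : ℝ≥0∞) (f : EuclideanSpace ℝ (Fin N) → ℝ → ℝ) (t : ℝ) :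
    ℝ≥0∞ :=
  ENNReal.ofReal ((1 + t) ^ (K / d)) *
      (ENNReal.ofReal (t ^ (((N : ℝ) / d) * (1 - q.toReal⁻¹))) *
          eLpNorm (fun x => f x t) q volume +
        eLpNorm (fun x => f x t) 1 volume) +
    wnorm N K (fun x => f x t)

/-- `t^{(N/d)(1-1/q)} ‖w(t)‖_q + t^{-ℓ/d} |||w(t)|||_ℓ`. -/
def DistQ (N : ℕ) (d : ℝ) (q : ℝ≥0∞) (ℓ : ℝ) (w : EuclideanSpace ℝ (Fin N) → ℝ → ℝ)
    (t : ℝ) : ℝ≥0∞ :=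
  ENNReal.ofReal (t ^ (((N : ℝ) / d) * (1 - q.toReal⁻¹))) * eLpNorm (fun x => w x t) q volume +
    ENNReal.ofReal (t ^ (-ℓ / d)) * wnorm N ℓ (fun x => w x t)

end
section TaylorRemainder

variable {E : Type*} [NormedAddCommGroup E] [NormedSpace ℝ E]

theorem iteratedDeriv_comp_add_smul {g : E → ℝ} {n : WithTop ℕ∞} (hg : ContDiff ℝ n g)
    (x h : E) (s : ℝ) {j : ℕ} (hj : j ≤ n) :
    iteratedDeriv j (fun s : ℝ => g (x + s • h)) s =
      iteratedFDeriv ℝ j g (x + s • h) (fun _ => h) := by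
  have hgx : ContDiff ℝ n (fun z => g (x + z)) := hg.comp (contDiff_const.add contDiff_id)
  have := ((ContinuousLinearMap.id ℝ ℝ).smulRight h).iteratedFDeriv_comp_right hgx s hj
  rw [iteratedDeriv_eq_iteratedFDeriv]
  have e : (fun s : ℝ => g (x + s • h)) =
    (fun z => g (x + z)) ∘ ((ContinuousLinearMap.id ℝ ℝ).smulRight h) := by
    ext s; simp
  rw [e, this, iteratedFDeriv_comp_add_left]
  simp

/-- The remainder at `x + h` of the Taylor expansion of order `m` of `g` at `x`. -/
noncomputable def taylorRem (g : E → ℝ) (m : ℕ) (x h : E) : ℝ :=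
  g (x + h) - ∑ j ∈ Finset.range (m + 1),
    (j.factorial : ℝ)⁻¹ * iteratedFDeriv ℝ j g x (fun _ => h)

theorem abs_taylorRem_le {g : E → ℝ} {m : ℕ} (hg : ContDiff ℝ (m + 1) g) {x h : E} {C : ℝ}
    (hC : ∀ s ∈ Set.Icc (0 : ℝ) 1, ‖iteratedFDeriv ℝ (m + 1) g (x + s • h)‖ ≤ C) :
    |taylorRem g m x h| ≤ C * ‖h‖ ^ (m + 1) := by
  set f : ℝ → ℝ := fun s => g (x + s • h) with hf
  have hfc : ContDiff ℝ (m + 1) f :=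
    hg.comp (contDiff_const.add (contDiff_id.smul contDiff_const))
  have hder : ∀ j ≤ m + 1, ∀ s ∈ Set.Icc (0 : ℝ) 1,
      iteratedDerivWithin j f (Set.Icc 0 1) s =
        iteratedFDeriv ℝ j g (x + s • h) (fun _ => h) := by
    intro j hj s hs
    have hj' : (j : WithTop ℕ∞) ≤ (m + 1 : WithTop ℕ∞) := by exact_mod_cast hj
    rw [iteratedDerivWithin_eq_iteratedDeriv (uniqueDiffOn_Icc zero_lt_one)
      (hfc.of_le hj').contDiffAt hs]
    exact iteratedDeriv_comp_add_smul hg x h s hj'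
  have hC0 : 0 ≤ C := (norm_nonneg _).trans (hC 0 (by simp))
  have key := taylor_mean_remainder_bound (f := f) (C := C * ‖h‖ ^ (m + 1)) (n := m)
    zero_le_one hfc.contDiffOn (Set.right_mem_Icc.2 zero_le_one) (by
      intro s hs
      rw [hder (m + 1) le_rfl s hs]
      refine (ContinuousMultilinearMap.le_opNorm _ _).trans ?_
      simp only [Finset.prod_const, Finset.card_univ, Fintype.card_fin]
      gcongr
      exact hC s hs)
  have hval : f 1 - taylorWithinEval f m (Set.Icc 0 1) 0 1 = taylorRem g m x h := by
    rw [taylor_within_apply, taylorRem]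
    congr 1
    · simp [hf]
    · refine Finset.sum_congr rfl fun j hj => ?_
      rw [hder j (Finset.mem_range.1 hj).le 0 (by simp)]
      simp
  rw [hval, Real.norm_eq_abs] at key
  refine key.trans ?_
  simp only [sub_zero, one_pow, mul_one]
  exact div_le_self (by positivity) (by exact_mod_cast Nat.one_le_iff_ne_zero.2 m.factorial_ne_zero)

theorem continuous_taylorRem {g : E → ℝ} {m : ℕ} (hg : ContDiff ℝ (m + 1) g) :
    Continuous fun p : E × E => taylorRem g m p.1 p.2 := by
  unfold taylorRem
  refine (hg.continuous.comp (continuous_fst.add continuous_snd)).sub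
    (continuous_finsetSum _ fun j hj => continuous_const.mul ?_)
  have hj' : (j : WithTop ℕ∞) ≤ (m + 1 : WithTop ℕ∞) := by
    exact_mod_cast (Finset.mem_range.1 hj).le
  have h1 := (hg.continuous_iteratedFDeriv hj').comp (continuous_fst (X := E) (Y := E))
  exact continuous_eval.comp (h1.prodMk (continuous_pi fun _ => continuous_snd))

theorem abs_taylorRem_le_of_norm_le_one {g : E → ℝ} {m : ℕ} (hg : ContDiff ℝ (m + 1) g)
    {C r : ℝ} (hr : 0 ≤ r)
    (hdec : ∀ x, ‖iteratedFDeriv ℝ (m + 1) g x‖ ≤ C * (1 + ‖x‖) ^ (-r))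
    (x : E) {h : E} (hh : ‖h‖ ≤ 1) :
    |taylorRem g m x h| ≤ C * 2 ^ r * ‖h‖ ^ (m + 1) * (1 + ‖x‖) ^ (-r) := by
  have hC : 0 ≤ C := by
    have := (norm_nonneg _).trans (hdec 0)
    simpa using this
  have := abs_taylorRem_le hg (x := x) (h := h) (C := C * (2 ^ r * (1 + ‖x‖) ^ (-r))) (by
    intro s hs
    refine (hdec _).trans ?_
    have h1 : (1 + ‖x‖) / 2 ≤ 1 + ‖x + s • h‖ := by
      have h2 : ‖s • h‖ ≤ 1 := by
        rw [norm_smul, Real.norm_of_nonneg hs.1]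
        exact mul_le_one₀ hs.2 (norm_nonneg _) hh
      have h3 : ‖x‖ ≤ ‖x + s • h‖ + ‖s • h‖ := by
        simpa using norm_sub_le (x + s • h) (s • h)
      have := norm_nonneg (x + s • h)
      linarith
    have h4 : (1 + ‖x + s • h‖) ^ (-r) ≤ ((1 + ‖x‖) / 2) ^ (-r) :=
      Real.rpow_le_rpow_of_nonpos (by positivity) h1 (by linarith)
    have h5 : ((1 + ‖x‖) / 2) ^ (-r) = 2 ^ r * (1 + ‖x‖) ^ (-r) := by
      rw [Real.div_rpow (by positivity) (by positivity), Real.rpow_neg (by positivity : (0:ℝ) ≤ 2)]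
      field_simp
    gcongr
    exact h4.trans h5.le)
  refine this.trans (le_of_eq (by ring))

theorem abs_taylorRem_le_of_one_le_norm {g : E → ℝ} {m : ℕ} {C r k : ℝ} (hmk : m ≤ k)
    (hdec : ∀ j ≤ m, ∀ x, ‖iteratedFDeriv ℝ j g x‖ ≤ C * (1 + ‖x‖) ^ (-r))
    (x : E) {h : E} (hh : 1 ≤ ‖h‖) :
    |taylorRem g m x h| ≤ C * (1 + ‖x + h‖) ^ (-r) +
      (m + 1) * C * ‖h‖ ^ k * (1 + ‖x‖) ^ (-r) := by
  have hC : 0 ≤ C := by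
    have := (norm_nonneg _).trans (hdec 0 (Nat.zero_le _) 0)
    simpa using this
  unfold taylorRem
  refine (abs_sub _ _).trans (add_le_add ?_ ?_)
  · simpa using hdec 0 (Nat.zero_le _) (x + h)
  · refine (Finset.abs_sum_le_sum_abs _ _).trans ?_
    have : ∀ j ∈ Finset.range (m + 1),
        |(j.factorial : ℝ)⁻¹ * iteratedFDeriv ℝ j g x (fun _ => h)| ≤
          C * ‖h‖ ^ k * (1 + ‖x‖) ^ (-r) := by
      intro j hj
      have hjm : j ≤ m := Nat.lt_succ_iff.1 (Finset.mem_range.1 hj)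
      rw [abs_mul, abs_of_nonneg (by positivity)]
      have h1 : (j.factorial : ℝ)⁻¹ ≤ 1 :=
        inv_le_one_of_one_le₀ (by exact_mod_cast Nat.one_le_iff_ne_zero.2 j.factorial_ne_zero)
      have h2 : |iteratedFDeriv ℝ j g x (fun _ => h)| ≤ C * (1 + ‖x‖) ^ (-r) * ‖h‖ ^ j := by
        rw [← Real.norm_eq_abs]
        refine (ContinuousMultilinearMap.le_opNorm _ _).trans ?_
        simp only [Finset.prod_const, Finset.card_univ, Fintype.card_fin]
        gcongr
        exact hdec j hjm x
      have h3 : ‖h‖ ^ j ≤ ‖h‖ ^ k := by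
        rw [← Real.rpow_natCast]
        exact Real.rpow_le_rpow_of_exponent_le hh (le_trans (by exact_mod_cast hjm) hmk)
      calc _ ≤ 1 * (C * (1 + ‖x‖) ^ (-r) * ‖h‖ ^ k) := by
            refine mul_le_mul h1 (h2.trans ?_) (abs_nonneg _) zero_le_one
            gcongr
        _ = _ := by ring
    refine (Finset.sum_le_card_nsmul _ _ _ this).trans (le_of_eq ?_)
    simp; ring

variable [FiniteDimensional ℝ E] [MeasurableSpace E] [BorelSpace E]

/-- Weighted `L¹` bound of the Taylor remainder of a function with decaying derivatives. -/
theorem exists_lintegral_taylorRem_le (μ : Measure E) [μ.IsAddHaarMeasure] {g : E → ℝ} {m : ℕ}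
    (hg : ContDiff ℝ (m + 1) g) {C r k ℓ : ℝ} (hℓ : 0 ≤ ℓ) (hℓk : ℓ ≤ k) (hmk : m ≤ k)
    (hkm : k ≤ m + 1) (hr : Module.finrank ℝ E + ℓ < r)
    (hdec : ∀ j ≤ m + 1, ∀ x, ‖iteratedFDeriv ℝ j g x‖ ≤ C * (1 + ‖x‖) ^ (-r)) :
    ∃ K : ℝ, 0 ≤ K ∧ ∀ h : E, ∫⁻ x, ENNReal.ofReal (‖x‖ ^ ℓ * |taylorRem g m x h|) ∂μ ≤
      ENNReal.ofReal (K * min (‖h‖ ^ k) (‖h‖ ^ (m + 1))) := by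
  have hC : 0 ≤ C := by
    have := (norm_nonneg _).trans (hdec 0 (Nat.zero_le _) 0)
    simpa using this
  have hr0 : 0 ≤ r := by
    have : (0 : ℝ) ≤ Module.finrank ℝ E := Nat.cast_nonneg _
    linarith
  set J : ℝ≥0∞ := ∫⁻ x, ENNReal.ofReal ((1 + ‖x‖) ^ (-(r - ℓ))) ∂μ with hJ
  have hJfin : J < ⊤ := finite_integral_one_add_norm (by linarith)
  have hsplit : ∀ x : E, (1 + ‖x‖) ^ (-(r - ℓ)) = (1 + ‖x‖) ^ ℓ * (1 + ‖x‖) ^ (-r) := by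
    intro x
    rw [← Real.rpow_add (by positivity)]
    congr 1; ring
  have hpow : ∀ x : E, ‖x‖ ^ ℓ ≤ (1 + ‖x‖) ^ ℓ := fun x =>
    Real.rpow_le_rpow (norm_nonneg _) (by linarith) hℓ
  have hmeas : ∀ a : ℝ, Measurable fun x : E =>
      ENNReal.ofReal (a * (1 + ‖x‖) ^ (-(r - ℓ))) := by
    intro a; fun_prop
  have hJmul : ∀ a : ℝ, 0 ≤ a → ∫⁻ x, ENNReal.ofReal (a * (1 + ‖x‖) ^ (-(r - ℓ))) ∂μ =
      ENNReal.ofReal (a * J.toReal) := by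
    intro a ha
    simp_rw [ENNReal.ofReal_mul ha]
    rw [lintegral_const_mul' _ _ ENNReal.ofReal_ne_top, ← hJ, ENNReal.ofReal_toReal hJfin.ne]
  refine ⟨(C * 2 ^ r + (2 ^ ℓ + (m + 1)) * C) * J.toReal, by positivity, fun h => ?_⟩
  rcases le_total ‖h‖ 1 with hh | hh
  · have hmin : min (‖h‖ ^ k) (‖h‖ ^ (m + 1)) = ‖h‖ ^ (m + 1) := by
      refine min_eq_right ?_
      rcases (norm_nonneg h).eq_or_lt with h0 | h0
      · rw [← h0, zero_pow (Nat.succ_ne_zero m)]; exact Real.rpow_nonneg le_rfl _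
      · rw [← Real.rpow_natCast]
        exact Real.rpow_le_rpow_of_exponent_ge h0 hh (by push_cast; exact hkm)
    calc ∫⁻ x, ENNReal.ofReal (‖x‖ ^ ℓ * |taylorRem g m x h|) ∂μ
        ≤ ∫⁻ x, ENNReal.ofReal (C * 2 ^ r * ‖h‖ ^ (m + 1) * (1 + ‖x‖) ^ (-(r - ℓ))) ∂μ := by
          refine lintegral_mono fun x => ?_
          refine ENNReal.ofReal_le_ofReal ?_
          rw [hsplit]
          calc _ ≤ (1 + ‖x‖) ^ ℓ * (C * 2 ^ r * ‖h‖ ^ (m + 1) * (1 + ‖x‖) ^ (-r)) :=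
                mul_le_mul (hpow x) (abs_taylorRem_le_of_norm_le_one hg hr0 (hdec _ le_rfl) x hh)
                  (abs_nonneg _) (by positivity)
            _ = _ := by ring
      _ = ENNReal.ofReal (C * 2 ^ r * ‖h‖ ^ (m + 1) * J.toReal) := hJmul _ (by positivity)
      _ ≤ _ := by
          refine ENNReal.ofReal_le_ofReal ?_
          rw [hmin]
          have : 0 ≤ (2 ^ ℓ + (m + 1)) * C * J.toReal * ‖h‖ ^ (m + 1) := by positivity
          nlinarith
  · have hmin : min (‖h‖ ^ k) (‖h‖ ^ (m + 1)) = ‖h‖ ^ k := by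
      refine min_eq_left ?_
      rw [← Real.rpow_natCast]
      exact Real.rpow_le_rpow_of_exponent_le hh (by push_cast; exact hkm)
    have hh1 : (1 + ‖h‖) ^ ℓ ≤ 2 ^ ℓ * ‖h‖ ^ k := by
      calc (1 + ‖h‖) ^ ℓ ≤ (2 * ‖h‖) ^ ℓ :=
            Real.rpow_le_rpow (by positivity) (by linarith) hℓ
        _ = 2 ^ ℓ * ‖h‖ ^ ℓ := Real.mul_rpow (by positivity) (by positivity)
        _ ≤ _ := by gcongr
    calc ∫⁻ x, ENNReal.ofReal (‖x‖ ^ ℓ * |taylorRem g m x h|) ∂μ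
        ≤ ∫⁻ x, (ENNReal.ofReal (C * (2 ^ ℓ * ‖h‖ ^ k) * (1 + ‖x + h‖) ^ (-(r - ℓ))) +
            ENNReal.ofReal ((m + 1) * C * ‖h‖ ^ k * (1 + ‖x‖) ^ (-(r - ℓ)))) ∂μ := by
          refine lintegral_mono fun x => ?_
          rw [← ENNReal.ofReal_add (by positivity) (by positivity)]
          refine ENNReal.ofReal_le_ofReal ?_
          have h1 : ‖x‖ ^ ℓ ≤ (2 ^ ℓ * ‖h‖ ^ k) * (1 + ‖x + h‖) ^ ℓ := by
            have h2 : ‖x‖ ≤ (1 + ‖h‖) * (1 + ‖x + h‖) := by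
              have h3 : ‖x‖ ≤ ‖x + h‖ + ‖h‖ := by simpa using norm_sub_le (x + h) h
              nlinarith [norm_nonneg h, norm_nonneg (x + h)]
            calc ‖x‖ ^ ℓ ≤ ((1 + ‖h‖) * (1 + ‖x + h‖)) ^ ℓ :=
                  Real.rpow_le_rpow (norm_nonneg _) h2 hℓ
              _ = (1 + ‖h‖) ^ ℓ * (1 + ‖x + h‖) ^ ℓ :=
                  Real.mul_rpow (by positivity) (by positivity)
              _ ≤ _ := by gcongr
          have h4 := abs_taylorRem_le_of_one_le_norm hmk
            (fun j hj => hdec j (hj.trans (Nat.le_succ m))) x hh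
          rw [hsplit, hsplit]
          calc _ ≤ ‖x‖ ^ ℓ * (C * (1 + ‖x + h‖) ^ (-r) +
                (m + 1) * C * ‖h‖ ^ k * (1 + ‖x‖) ^ (-r)) := by gcongr
            _ = ‖x‖ ^ ℓ * (C * (1 + ‖x + h‖) ^ (-r)) +
                ‖x‖ ^ ℓ * ((m + 1) * C * ‖h‖ ^ k * (1 + ‖x‖) ^ (-r)) := by ring
            _ ≤ (2 ^ ℓ * ‖h‖ ^ k) * (1 + ‖x + h‖) ^ ℓ * (C * (1 + ‖x + h‖) ^ (-r)) +
                (1 + ‖x‖) ^ ℓ * ((m + 1) * C * ‖h‖ ^ k * (1 + ‖x‖) ^ (-r)) := by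
              have := hpow x
              gcongr
            _ = _ := by ring
      _ = ENNReal.ofReal (C * (2 ^ ℓ * ‖h‖ ^ k) * J.toReal) +
            ENNReal.ofReal ((m + 1) * C * ‖h‖ ^ k * J.toReal) := by
          rw [lintegral_add_right _ (hmeas _),
            lintegral_add_right_eq_self
              (fun x : E => ENNReal.ofReal (C * (2 ^ ℓ * ‖h‖ ^ k) * (1 + ‖x‖) ^ (-(r - ℓ)))) h]
          rw [hJmul _ (by positivity), hJmul _ (by positivity)]
      _ ≤ _ := by
          rw [← ENNReal.ofReal_add (by positivity) (by positivity)]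
          refine ENNReal.ofReal_le_ofReal ?_
          rw [hmin]
          have : 0 ≤ C * 2 ^ r * J.toReal * ‖h‖ ^ k := by positivity
          nlinarith

end TaylorRemainder

section Convolution

theorem pow_le_one_add_rpow {x k : ℝ} (hx : 0 ≤ x) {j : ℕ} (hjk : j ≤ k) :
    x ^ j ≤ 1 + x ^ k := by
  rcases le_total x 1 with h | h
  · have := pow_le_one₀ (n := j) hx h
    have := Real.rpow_nonneg hx k
    linarith
  · have : x ^ (j : ℝ) ≤ x ^ k := Real.rpow_le_rpow_of_exponent_le h hjk
    rw [Real.rpow_natCast] at this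
    linarith

theorem integrable_mul_of_abs_le_one_add_rpow {E : Type*} [NormedAddCommGroup E]
    [MeasurableSpace E] [BorelSpace E] {μ : Measure E} {k M : ℝ} {φ F : E → ℝ}
    (hφm : AEStronglyMeasurable φ μ)
    (hφ : Integrable (fun y => (1 + ‖y‖ ^ k) * φ y) μ)
    (hF : Continuous F) (hFM : ∀ y, |F y| ≤ M * (1 + ‖y‖ ^ k)) :
    Integrable (fun y => F y * φ y) μ := by
  refine (hφ.norm.const_mul M).mono' (hF.aestronglyMeasurable.mul hφm)
    (Eventually.of_forall fun y => ?_)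
  have : 0 ≤ 1 + ‖y‖ ^ k := by positivity
  rw [norm_mul, norm_mul, Real.norm_of_nonneg this, ← mul_assoc]
  exact mul_le_mul_of_nonneg_right (hFM y) (norm_nonneg _)

variable {E : Type*} [NormedAddCommGroup E] [NormedSpace ℝ E] [MeasurableSpace E]

theorem integrable_multilinear_diag_mul [BorelSpace E] {μ : Measure E} {k : ℝ} {φ : E → ℝ}
    (hφm : AEStronglyMeasurable φ μ)
    (hφ : Integrable (fun y => (1 + ‖y‖ ^ k) * φ y) μ) {j : ℕ} (hjk : j ≤ k)
    (T : ContinuousMultilinearMap ℝ (fun _ : Fin j => E) ℝ) :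
    Integrable (fun y => T (fun _ => y) * φ y) μ := by
  refine integrable_mul_of_abs_le_one_add_rpow (M := ‖T‖) hφm hφ
    (T.cont.comp (continuous_pi fun _ => continuous_id)) fun y => ?_
  rw [← Real.norm_eq_abs]
  refine (T.le_opNorm _).trans ?_
  simp only [Finset.prod_const, Finset.card_univ, Fintype.card_fin]
  gcongr
  exact pow_le_one_add_rpow (norm_nonneg y) hjk

theorem integral_taylorRem_mul [BorelSpace E] {μ : Measure E} {g : E → ℝ} (hg : Continuous g)
    {C : ℝ} (hC : ∀ x, |g x| ≤ C) {m : ℕ} {k : ℝ} (hmk : m ≤ k) {φ : E → ℝ}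
    (hφm : AEStronglyMeasurable φ μ)
    (hφ : Integrable (fun y => (1 + ‖y‖ ^ k) * φ y) μ)
    (hmom : ∀ j ≤ m, ∀ T : ContinuousMultilinearMap ℝ (fun _ : Fin j => E) ℝ,
      ∫ y, T (fun _ => y) * φ y ∂μ = 0) (x : E) (c : ℝ) :
    ∫ y, taylorRem g m x (c • y) * φ y ∂μ = ∫ y, g (x + c • y) * φ y ∂μ := by
  have hjk : ∀ j ∈ Finset.range (m + 1), (j : ℝ) ≤ k := fun j hj =>
    le_trans (by exact_mod_cast Nat.lt_succ_iff.1 (Finset.mem_range.1 hj)) hmk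
  have hC0 : 0 ≤ C := (abs_nonneg _).trans (hC 0)
  have hgi : Integrable (fun y => g (x + c • y) * φ y) μ := by
    refine integrable_mul_of_abs_le_one_add_rpow (M := C) hφm hφ (by fun_prop) fun y => ?_
    have : (0 : ℝ) ≤ ‖y‖ ^ k := by positivity
    exact (hC _).trans (le_mul_of_one_le_right hC0 (by linarith))
  have hterm : ∀ j, (fun y => (j.factorial : ℝ)⁻¹ *
      iteratedFDeriv ℝ j g x (fun _ => c • y) * φ y) =
      fun y => ((j.factorial : ℝ)⁻¹ * c ^ j) * (iteratedFDeriv ℝ j g x (fun _ => y) * φ y) := by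
    intro j
    ext y
    have := (iteratedFDeriv ℝ j g x).map_smul_univ (fun _ => c) (fun _ => y)
    simp only [Finset.prod_const, Finset.card_univ, Fintype.card_fin, smul_eq_mul] at this
    rw [this]
    ring
  have hTi : ∀ j ∈ Finset.range (m + 1), Integrable (fun y => (j.factorial : ℝ)⁻¹ *
      iteratedFDeriv ℝ j g x (fun _ => c • y) * φ y) μ := by
    intro j hj
    rw [hterm]
    exact (integrable_multilinear_diag_mul hφm hφ (hjk j hj) _).const_mul _
  simp only [taylorRem, sub_mul, Finset.sum_mul]
  rw [integral_sub hgi (integrable_finsetSum _ hTi), integral_finsetSum _ hTi, sub_eq_self]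
  refine Finset.sum_eq_zero fun j hj => ?_
  rw [hterm, integral_const_mul, hmom j (Nat.lt_succ_iff.1 (Finset.mem_range.1 hj)), mul_zero]

variable [FiniteDimensional ℝ E] [BorelSpace E]

theorem lintegral_abs_integral_comp_add_smul_mul_le {μ : Measure E} [SFinite μ] {g : E → ℝ} {m : ℕ}
    (hg : ContDiff ℝ (m + 1) g) {C : ℝ} (hC : ∀ x, |g x| ≤ C) {k ℓ : ℝ} (hmk : m ≤ k)
    {φ : E → ℝ} (hφm : AEStronglyMeasurable φ μ)
    (hφ : Integrable (fun y => (1 + ‖y‖ ^ k) * φ y) μ)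
    (hmom : ∀ j ≤ m, ∀ T : ContinuousMultilinearMap ℝ (fun _ : Fin j => E) ℝ,
      ∫ y, T (fun _ => y) * φ y ∂μ = 0)
    {b : E → ℝ}
    (hb : ∀ h, ∫⁻ x, ENNReal.ofReal (‖x‖ ^ ℓ * |taylorRem g m x h|) ∂μ ≤ ENNReal.ofReal (b h))
    (c : ℝ) :
    ∫⁻ x, ENNReal.ofReal (‖x‖ ^ ℓ * |∫ y, g (x + c • y) * φ y ∂μ|) ∂μ ≤
      ∫⁻ y, ENNReal.ofReal (b (c • y)) * ENNReal.ofReal |φ y| ∂μ := by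
  calc ∫⁻ x, ENNReal.ofReal (‖x‖ ^ ℓ * |∫ y, g (x + c • y) * φ y ∂μ|) ∂μ
      ≤ ∫⁻ x, ∫⁻ y, ENNReal.ofReal (‖x‖ ^ ℓ * |taylorRem g m x (c • y)|) *
          ENNReal.ofReal |φ y| ∂μ ∂μ := by
        refine lintegral_mono fun x => ?_
        rw [← integral_taylorRem_mul hg.continuous hC hmk hφm hφ hmom,
          ENNReal.ofReal_mul (by positivity), ← Real.norm_eq_abs, ofReal_norm]
        refine (mul_le_mul_right (enorm_integral_le_lintegral_enorm _) _).trans (le_of_eq ?_)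
        rw [← lintegral_const_mul' _ _ ENNReal.ofReal_ne_top]
        refine lintegral_congr fun y => ?_
        rw [ENNReal.ofReal_mul (by positivity), enorm_mul, ← Real.norm_eq_abs, ← Real.norm_eq_abs,
          ofReal_norm, ofReal_norm, mul_assoc]
    _ = ∫⁻ y, ∫⁻ x, ENNReal.ofReal (‖x‖ ^ ℓ * |taylorRem g m x (c • y)|) *
          ENNReal.ofReal |φ y| ∂μ ∂μ := by
        refine lintegral_lintegral_swap ?_
        have h1 : Measurable fun p : E × E => taylorRem g m p.1 (c • p.2) :=
          ((continuous_taylorRem hg).comp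
            (continuous_fst.prodMk (continuous_snd.const_smul c))).measurable
        have h2 : AEMeasurable (fun p : E × E => φ p.2) (μ.prod μ) :=
          hφm.comp_snd.aemeasurable
        have h3 : Measurable fun p : E × E => ‖p.1‖ ^ ℓ := by fun_prop
        exact ((h3.mul h1.norm).ennreal_ofReal.aemeasurable).mul h2.norm.ennreal_ofReal
    _ ≤ _ := by
        refine lintegral_mono fun y => ?_
        rw [lintegral_mul_const' _ _ ENNReal.ofReal_ne_top]
        gcongr
        exact hb _

theorem tendsto_rpow_mul_lintegral_abs_integral (μ : Measure E) [μ.IsAddHaarMeasure] {g : E → ℝ}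
    {m : ℕ} (hg : ContDiff ℝ (m + 1) g) {C r k ℓ : ℝ} (hℓ : 0 ≤ ℓ) (hℓk : ℓ ≤ k) (hmk : m ≤ k)
    (hkm : k < m + 1) (hr : Module.finrank ℝ E + ℓ < r)
    (hdec : ∀ j ≤ m + 1, ∀ x, ‖iteratedFDeriv ℝ j g x‖ ≤ C * (1 + ‖x‖) ^ (-r))
    {φ : E → ℝ} (hφm : AEStronglyMeasurable φ μ)
    (hφ : Integrable (fun y => (1 + ‖y‖ ^ k) * φ y) μ)
    (hmom : ∀ j ≤ m, ∀ T : ContinuousMultilinearMap ℝ (fun _ : Fin j => E) ℝ,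
      ∫ y, T (fun _ => y) * φ y ∂μ = 0) :
    Tendsto (fun s : ℝ => ENNReal.ofReal (s ^ k) *
      ∫⁻ x, ENNReal.ofReal (‖x‖ ^ ℓ * |∫ y, g (x - s⁻¹ • y) * φ y ∂μ|) ∂μ) atTop (𝓝 0) := by
  have hC0 : 0 ≤ C := by
    have := (norm_nonneg _).trans (hdec 0 (Nat.zero_le _) 0)
    simpa using this
  have hr0 : 0 ≤ r := by
    have : (0 : ℝ) ≤ Module.finrank ℝ E := Nat.cast_nonneg _
    linarith
  have hC : ∀ x, |g x| ≤ C := by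
    intro x
    have h1 := hdec 0 (Nat.zero_le _) x
    rw [norm_iteratedFDeriv_zero] at h1
    refine h1.trans (mul_le_of_le_one_right hC0 ?_)
    exact Real.rpow_le_one_of_one_le_of_nonpos (by simp) (by linarith)
  obtain ⟨K, hK, hb⟩ := exists_lintegral_taylorRem_le μ hg hℓ hℓk hmk hkm.le hr hdec
  set F : ℝ → E → ℝ := fun s y => K * min (‖y‖ ^ k) (‖y‖ ^ (m + 1) * s ^ (k - (m + 1))) * |φ y|
    with hF
  have hle : ∀ᶠ s : ℝ in atTop, ENNReal.ofReal (s ^ k) *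
      ∫⁻ x, ENNReal.ofReal (‖x‖ ^ ℓ * |∫ y, g (x - s⁻¹ • y) * φ y ∂μ|) ∂μ ≤
      ∫⁻ y, ENNReal.ofReal (F s y) ∂μ := by
    filter_upwards [eventually_gt_atTop 0] with s hs
    have h1 := lintegral_abs_integral_comp_add_smul_mul_le hg hC hmk hφm hφ hmom hb (-s⁻¹)
    simp only [neg_smul, ← sub_eq_add_neg] at h1
    refine (mul_le_mul_right h1 _).trans (le_of_eq ?_)
    rw [← lintegral_const_mul' _ _ ENNReal.ofReal_ne_top]
    refine lintegral_congr fun y => ?_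
    rw [← ENNReal.ofReal_mul (by positivity), ← ENNReal.ofReal_mul (by positivity)]
    congr 1
    have e : ‖-(s⁻¹ • y)‖ = s⁻¹ * ‖y‖ := by
      rw [norm_neg, norm_smul, Real.norm_of_nonneg (by positivity)]
    have hsk : s ^ k ≠ 0 := by positivity
    have e1 : s ^ k * (s⁻¹ * ‖y‖) ^ k = ‖y‖ ^ k := by
      rw [Real.mul_rpow (by positivity) (by positivity), Real.inv_rpow hs.le, mul_inv_cancel_left₀ hsk]
    have e2 : s ^ k * (s⁻¹ * ‖y‖) ^ (m + 1) = ‖y‖ ^ (m + 1) * s ^ (k - (m + 1)) := by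
      rw [mul_pow, Real.rpow_sub hs]
      have : s ^ ((m : ℝ) + 1) = s ^ (m + 1) := by exact_mod_cast Real.rpow_natCast s (m + 1)
      rw [this, inv_pow]
      field_simp
    rw [e, hF]
    calc _ = K * (s ^ k * min ((s⁻¹ * ‖y‖) ^ k) ((s⁻¹ * ‖y‖) ^ (m + 1))) * |φ y| := by ring
      _ = _ := by rw [mul_min_of_nonneg _ _ (by positivity), e1, e2]
  refine tendsto_of_tendsto_of_tendsto_of_le_of_le' tendsto_const_nhds ?_
    (Eventually.of_forall fun _ => zero_le) hle
  have hzero : (0 : ℝ≥0∞) = ∫⁻ y : E, 0 ∂μ := by simp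
  rw [hzero]
  refine tendsto_lintegral_filter_of_dominated_convergence'
    (fun y => ENNReal.ofReal (K * ‖(1 + ‖y‖ ^ k) * φ y‖)) ?_ ?_ ?_ ?_
  · refine Eventually.of_forall fun s => ?_
    have h2 : AEMeasurable φ μ := hφm.aemeasurable
    have h3 : Measurable fun y : E =>
        K * min (‖y‖ ^ k) (‖y‖ ^ (m + 1) * s ^ (k - (m + 1))) := by fun_prop
    exact (h3.aemeasurable.mul h2.norm).ennreal_ofReal
  · refine Eventually.of_forall fun s => Eventually.of_forall fun y => ?_
    refine ENNReal.ofReal_le_ofReal ?_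
    have h0 : 0 ≤ ‖y‖ ^ k := by positivity
    rw [norm_mul, Real.norm_of_nonneg (by positivity : 0 ≤ 1 + ‖y‖ ^ k), Real.norm_eq_abs,
      ← mul_assoc]
    simp only [hF]
    gcongr
    exact (min_le_left _ _).trans (by linarith)
  · exact ((hφ.norm.const_mul K).lintegral_lt_top).ne
  · refine Eventually.of_forall fun y => ?_
    rw [← ENNReal.ofReal_zero]
    refine ENNReal.tendsto_ofReal ?_
    have h1 : Tendsto (fun s : ℝ => s ^ (k - (m + 1))) atTop (𝓝 0) := by
      have := tendsto_rpow_neg_atTop (show 0 < m + 1 - k by linarith)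
      simpa using this
    have h2 := (tendsto_const_nhds (x := ‖y‖ ^ k)).min (h1.const_mul (‖y‖ ^ (m + 1)))
    rw [mul_zero, min_eq_right (by positivity)] at h2
    have h3 := (h2.const_mul K).mul_const |φ y|
    simpa [hF] using h3

end Convolution

section EuclideanKernel

variable {N : ℕ}

theorem multilinear_diag_eq_sum_mpowE {j : ℕ}
    (T : ContinuousMultilinearMap ℝ (fun _ : Fin j => EuclideanSpace ℝ (Fin N)) ℝ)
    (y : EuclideanSpace ℝ (Fin N)) :
    T (fun _ => y) = ∑ r : Fin j → Fin N,
      mpowE N (fun c => (Finset.univ.filter fun i => r i = c).card) y *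
        T (fun i => EuclideanSpace.single (r i) 1) := by
  have hy : y = ∑ c, y c • EuclideanSpace.single c (1 : ℝ) := by
    simpa using ((EuclideanSpace.basisFun (Fin N) ℝ).sum_repr y).symm
  have h1 := T.toMultilinearMap.map_sum
    (fun (_ : Fin j) (c : Fin N) => y c • EuclideanSpace.single c (1 : ℝ))
  rw [← hy] at h1
  refine h1.trans (Finset.sum_congr rfl fun r _ => ?_)
  have h2 := T.map_smul_univ (fun i => y (r i)) (fun i => EuclideanSpace.single (r i) (1 : ℝ))
  refine h2.trans ?_
  rw [smul_eq_mul, mpowE, ← Finset.prod_fiberwise Finset.univ r]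
  congr 1
  refine Finset.prod_congr rfl fun c _ => ?_
  rw [Finset.prod_congr rfl (g := fun _ => y c)
    (fun i hi => by rw [(Finset.mem_filter.1 hi).2]), Finset.prod_const]

theorem sum_card_fiber_eq {j : ℕ} (r : Fin j → Fin N) :
    ∑ c, (Finset.univ.filter fun i => r i = c).card = j := by
  simpa using (Finset.card_eq_sum_card_fiberwise (f := r) (s := Finset.univ) (t := Finset.univ)
    (fun _ _ => Finset.mem_coe.2 (Finset.mem_univ _))).symm

theorem abs_mpowE_le (α : Fin N → ℕ) (y : EuclideanSpace ℝ (Fin N)) :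
    |mpowE N α y| ≤ ‖y‖ ^ ∑ i, α i := by
  rw [mpowE, Finset.abs_prod, ← Finset.prod_pow_eq_pow_sum]
  refine Finset.prod_le_prod (fun _ _ => abs_nonneg _) fun i _ => ?_
  rw [abs_pow]
  gcongr
  exact PiLp.norm_apply_le y i

theorem integral_multilinear_diag_mul_eq_zero {k : ℝ} {φ : EuclideanSpace ℝ (Fin N) → ℝ}
    (hφm : AEStronglyMeasurable φ volume)
    (hφ : Integrable (fun y => (1 + ‖y‖ ^ k) * φ y))
    {j : ℕ} (hjk : j ≤ k)
    (hmom : ∀ α : Fin N → ℕ, ∑ i, α i = j → ∫ x, mpowE N α x * φ x = 0)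
    (T : ContinuousMultilinearMap ℝ (fun _ : Fin j => EuclideanSpace ℝ (Fin N)) ℝ) :
    ∫ y, T (fun _ => y) * φ y = 0 := by
  have hi : ∀ α : Fin N → ℕ, ∑ i, α i = j → Integrable fun y => mpowE N α y * φ y := by
    intro α hα
    refine integrable_mul_of_abs_le_one_add_rpow (M := 1) hφm hφ
      (by unfold mpowE; fun_prop) fun y => ?_
    rw [one_mul]
    refine (abs_mpowE_le α y).trans ?_
    rw [hα]
    exact pow_le_one_add_rpow (norm_nonneg y) hjk
  have e : ∀ y, T (fun _ => y) * φ y = ∑ r : Fin j → Fin N,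
      T (fun i => EuclideanSpace.single (r i) 1) *
        (mpowE N (fun c => (Finset.univ.filter fun i => r i = c).card) y * φ y) := by
    intro y
    rw [multilinear_diag_eq_sum_mpowE, Finset.sum_mul]
    exact Finset.sum_congr rfl fun r _ => by ring
  simp_rw [e]
  rw [integral_finsetSum _ fun r _ => (hi _ (sum_card_fiber_eq r)).const_mul _]
  refine Finset.sum_eq_zero fun r _ => ?_
  rw [integral_const_mul, hmom _ (sum_card_fiber_eq r), mul_zero]

theorem MemL1k.integrable {k : ℝ} {φ : EuclideanSpace ℝ (Fin N) → ℝ} (hφ : MemL1k N k φ) :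
    Integrable fun y => (1 + ‖y‖ ^ k) * φ y := by
  refine ⟨(Measurable.aestronglyMeasurable (by fun_prop)).mul hφ.1, ?_⟩
  refine lt_of_eq_of_lt (lintegral_congr fun y => ?_) hφ.2
  rw [← ofReal_norm, norm_mul, Real.norm_of_nonneg (by positivity : 0 ≤ 1 + ‖y‖ ^ k)]

theorem lintegral_eq_ofReal_pow_mul_lintegral_comp_smul {s : ℝ} (hs : 0 < s)
    (f : EuclideanSpace ℝ (Fin N) → ℝ≥0∞) :
    ∫⁻ x, f x = ENNReal.ofReal (s ^ N) * ∫⁻ x, f (s • x) := by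
  have h := (Homeomorph.smulOfNeZero (α := EuclideanSpace ℝ (Fin N)) s
    hs.ne').measurableEmbedding.lintegral_map (μ := volume) f
  have e : ⇑(Homeomorph.smulOfNeZero (α := EuclideanSpace ℝ (Fin N)) s hs.ne') =
    fun x => s • x := rfl
  rw [e, Measure.map_addHaar_smul _ hs.ne', lintegral_smul_measure, finrank_euclideanSpace_fin,
    abs_of_pos (by positivity)] at h
  rw [← h, smul_eq_mul, ← mul_assoc, ← ENNReal.ofReal_mul (by positivity),
    mul_inv_cancel₀ (by positivity), ENNReal.ofReal_one, one_mul]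

namespace CondG

variable {G : EuclideanSpace ℝ (Fin N) → ℝ → ℝ} {γ : ℕ} {d L : ℝ}

theorem contDiff_one (hG : CondG N G γ d L) : ContDiff ℝ γ fun x => G x 1 := by
  rw [← contDiffOn_univ]
  exact hG.smooth.comp (contDiff_id.prodMk contDiff_const).contDiffOn
    fun x _ => show (0 : ℝ) < 1 from one_pos

theorem exists_norm_iteratedFDeriv_le (hG : CondG N G γ d L) :
    ∃ C : ℝ, ∀ j ≤ γ, ∀ x, ‖iteratedFDeriv ℝ j (fun y => G y 1) x‖ ≤
      C * (1 + ‖x‖) ^ (-((N : ℝ) + L)) := by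
  choose! C hC using hG.decay
  refine ⟨∑ i ∈ Finset.range (γ + 1), |C i|, fun j hj x => ?_⟩
  have hx : 1 ≤ 1 + ‖x‖ := by simp
  have h1 : (1 + ‖x‖) ^ ((N : ℝ) + L) ≤ (1 + ‖x‖) ^ ((N : ℝ) + L + j) :=
    Real.rpow_le_rpow_of_exponent_le hx (by simp)
  have h2 : C j ≤ ∑ i ∈ Finset.range (γ + 1), |C i| := (le_abs_self _).trans
    (Finset.single_le_sum (f := fun i => |C i|) (fun _ _ => abs_nonneg _)
      (Finset.mem_range.2 (Nat.lt_succ_of_le hj)))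
  rw [Real.rpow_neg (by positivity), ← div_eq_mul_inv, le_div_iff₀ (by positivity), mul_comm]
  exact (mul_le_mul_of_nonneg_right h1 (norm_nonneg _)).trans ((hC j hj x).trans h2)

theorem sgOp_smul (hG : CondG N G γ d L) {t : ℝ} (ht : 0 < t)
    (φ : EuclideanSpace ℝ (Fin N) → ℝ) (x : EuclideanSpace ℝ (Fin N)) :
    sgOp N G t φ (t ^ (1 / d) • x) =
      ((t ^ (1 / d)) ^ N)⁻¹ * ∫ y, G (x - (t ^ (1 / d))⁻¹ • y) 1 * φ y := by
  have h1 : t ^ (-(1 : ℝ) / d) = (t ^ (1 / d))⁻¹ := by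
    rw [neg_div, Real.rpow_neg ht.le]
  have h2 : t ^ (-(N : ℝ) / d) = ((t ^ (1 / d)) ^ N)⁻¹ := by
    rw [neg_div, Real.rpow_neg ht.le, ← Real.rpow_mul_natCast ht.le]
    congr 2; ring
  rw [sgOp, ← integral_const_mul]
  congr 1 with y
  rw [hG.scaling _ t ht, h1, h2, smul_sub, inv_smul_smul₀ (by positivity), mul_assoc]

theorem rpow_mul_lintegral_sgOp (hG : CondG N G γ d L) {k ℓ t : ℝ} (ht : 0 < t)
    (φ : EuclideanSpace ℝ (Fin N) → ℝ) :
    ENNReal.ofReal (t ^ ((k - ℓ) / d)) *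
        ∫⁻ x, ENNReal.ofReal (‖x‖ ^ ℓ * |sgOp N G t φ x|) =
      ENNReal.ofReal ((t ^ (1 / d)) ^ k) *
        ∫⁻ x, ENNReal.ofReal (‖x‖ ^ ℓ * |∫ y, G (x - (t ^ (1 / d))⁻¹ • y) 1 * φ y|) := by
  set s := t ^ (1 / d) with hs
  have hs0 : 0 < s := by positivity
  have h1 : t ^ ((k - ℓ) / d) = s ^ k * (s ^ ℓ)⁻¹ := by
    rw [← div_eq_mul_inv, ← Real.rpow_sub hs0, hs, ← Real.rpow_mul ht.le]
    congr 1; ring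
  have h2 : ∀ x : EuclideanSpace ℝ (Fin N),
      ENNReal.ofReal (‖s • x‖ ^ ℓ * |sgOp N G t φ (s • x)|) =
      ENNReal.ofReal (s ^ ℓ * (s ^ N)⁻¹) *
        ENNReal.ofReal (‖x‖ ^ ℓ * |∫ y, G (x - s⁻¹ • y) 1 * φ y|) := by
    intro x
    rw [← ENNReal.ofReal_mul (by positivity), hG.sgOp_smul ht, norm_smul,
      Real.norm_of_nonneg hs0.le, Real.mul_rpow hs0.le (norm_nonneg _), abs_mul,
      abs_of_nonneg (by positivity : 0 ≤ (s ^ N)⁻¹)]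
    congr 1; ring
  rw [lintegral_eq_ofReal_pow_mul_lintegral_comp_smul hs0]
  simp_rw [h2]
  rw [lintegral_const_mul' _ _ ENNReal.ofReal_ne_top, ← mul_assoc, ← mul_assoc,
    ← ENNReal.ofReal_mul (by positivity), ← ENNReal.ofReal_mul (by positivity), h1]
  congr 2
  field_simp

/-- Decay of weighted `L¹` norms of `e^{tℒ}φ` when the moments of `φ` of order at most `k` vanish;
the regularity required of the kernel is `⌊k⌋₊ + 1 ≤ γ`. -/
theorem tendsto_rpow_mul_lintegral_sgOp (hG : CondG N G γ d L) (hd : 0 < d) {k ℓ : ℝ}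
    (hk0 : 0 ≤ k) (hkL : k < L) (hkγ : ⌊k⌋₊ + 1 ≤ γ) (hℓ : 0 ≤ ℓ) (hℓk : ℓ ≤ k)
    {φ : EuclideanSpace ℝ (Fin N) → ℝ} (hφ : MemL1k N k φ)
    (hmom : ∀ α : Fin N → ℕ, (∑ i, α i) ≤ ⌊k⌋₊ → ∫ x, mpowE N α x * φ x = 0) :
    Tendsto (fun t : ℝ => ENNReal.ofReal (t ^ ((k - ℓ) / d)) *
      ∫⁻ x, ENNReal.ofReal (‖x‖ ^ ℓ * |sgOp N G t φ x|)) atTop (𝓝 0) := by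
  obtain ⟨C, hC⟩ := hG.exists_norm_iteratedFDeriv_le
  have hmk : (⌊k⌋₊ : ℝ) ≤ k := Nat.floor_le hk0
  have hcd : ContDiff ℝ (⌊k⌋₊ + 1) fun x => G x 1 :=
    hG.contDiff_one.of_le (by exact_mod_cast hkγ)
  have hlim := tendsto_rpow_mul_lintegral_abs_integral volume hcd hℓ hℓk hmk
    (Nat.lt_floor_add_one k) (r := N + L) (by rw [finrank_euclideanSpace_fin]; linarith)
    (fun j hj => hC j (hj.trans hkγ)) hφ.1 hφ.integrable fun j hj =>
      integral_multilinear_diag_mul_eq_zero hφ.1 hφ.integrable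
        (le_trans (by exact_mod_cast hj) hmk) fun α hα => hmom α (hα.le.trans hj)
  refine (hlim.comp (tendsto_rpow_atTop (one_div_pos.2 hd))).congr' ?_
  filter_upwards [eventually_gt_atTop 0] with t ht
  exact (hG.rpow_mul_lintegral_sgOp ht φ).symm

end CondG

end EuclideanKernel

/-- Proposition 3.1 (iii): for `ℓ ∈ [0,k]` and every `φ ∈ L¹_k` with vanishing
moments up to order `k`, `t^{(k-ℓ)/d} ∫ |x|^ℓ |e^{tℒ}φ(x)| dx → 0` as `t → ∞`. -/
theorem stmt15 (N γ : ℕ) (hN : 1 ≤ N) (d L : ℝ) (hd : 0 < d) (hL : 0 < L)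
    (G : EuclideanSpace ℝ (Fin N) → ℝ → ℝ) (hG : CondG N G γ d L)
    (k : ℝ) (hk0 : 0 ≤ k) (hkL : k < L) (hkγ : ⌈k⌉₊ + 1 ≤ γ)
    (ℓ : ℝ) (hℓ : ℓ ∈ Set.Icc 0 k)
    (φ : EuclideanSpace ℝ (Fin N) → ℝ) (hφ : MemL1k N k φ)
    (hmom : ∀ α : Fin N → ℕ, (∑ i, α i) ≤ ⌊k⌋₊ → ∫ x, mpowE N α x * φ x = 0) :
    Tendsto (fun t : ℝ =>
        ENNReal.ofReal (t ^ ((k - ℓ) / d)) *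
          ∫⁻ x, ENNReal.ofReal (‖x‖ ^ ℓ * |sgOp N G t φ x|))
      atTop (nhds 0) := by
  exact hG.tendsto_rpow_mul_lintegral_sgOp hd hk0 hkL
    ((Nat.add_le_add_right (Nat.floor_le_ceil k) 1).trans hkγ) hℓ.1 hℓ.2 hφ hmom
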